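/- arXiv:2306.01628 — 2 statements merged into one kernel-verified Lean document; each statement's English description precedes it below -/
import Mathlib

section
/- Let (Σ_A, σ) be a one-sided topologically mixing countable (or finite) topological Markov shift with the big image and preimage property and μ the invariant Gibbs measure of a locally Hölder potential with finite Gurevich pressure, with Rényi entropy H₂(μ) > 0. Then for μ-almost every x ∈ Σ_A, limsup_{n→∞} M_n(x)/log n ≤ 2/H₂(μ). -/
open MeasureTheory Filter Topology

/-- The one-sided sequence space over the alphabet `I`. -/
abbrev SeqSp (I : Type) : Type := ℕ → I

/-- The left shift map `σ`. -/
def shift {I : Type} : SeqSp I → SeqSp I := fun x n => x (n + 1)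

/-- The topological Markov shift `Σ_A` determined by the 0-1 transition matrix `A`. -/
def SigmaA {I : Type} (A : I → I → Bool) : Set (SeqSp I) :=
  {x | ∀ i : ℕ, A (x i) (x (i + 1)) = true}

/-- The cylinder set (inside `Σ_A`) determined by a finite word `w`. -/
def cyl {I : Type} (A : I → I → Bool) {n : ℕ} (w : Fin n → I) : Set (SeqSp I) :=
  {y | y ∈ SigmaA A ∧ ∀ i : Fin n, y i.val = w i}

/-- The `m`-cylinder containing the point `x`. -/
def cylAt {I : Type} (A : I → I → Bool) (x : SeqSp I) (m : ℕ) : Set (SeqSp I) :=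
  {y | y ∈ SigmaA A ∧ ∀ i < m, y i = x i}

/-- Birkhoff sum `S_m φ = ∑_{i<m} φ ∘ σ^i`. -/
noncomputable def birkhoff {I : Type} (φ : SeqSp I → ℝ) (m : ℕ) (x : SeqSp I) : ℝ :=
  ∑ i ∈ Finset.range m, φ (shift^[i] x)

/-- A potential is locally Hölder: `var_k(φ) ≤ M ζ^k`. -/
def LocallyHolder {I : Type} (A : I → I → Bool) (φ : SeqSp I → ℝ) : Prop :=
  ∃ M > (0 : ℝ), ∃ ζ ∈ Set.Ioo (0 : ℝ) 1, ∀ k ≥ 1, ∀ x ∈ SigmaA A, ∀ y ∈ SigmaA A,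
    (∀ i < k, x i = y i) → |φ x - φ y| ≤ M * ζ ^ k

/-- `μ` is a Gibbs measure for the potential `φ`. -/
def IsGibbs {I : Type} [MeasurableSpace I] (A : I → I → Bool) (φ : SeqSp I → ℝ)
    (μ : Measure (SeqSp I)) : Prop :=
  ∃ c > (0 : ℝ), ∃ P : ℝ, ∀ x ∈ SigmaA A, ∀ m : ℕ,
    c⁻¹ * Real.exp (-(m : ℝ) * P + birkhoff φ m x) ≤ (μ (cylAt A x m)).toReal ∧
    (μ (cylAt A x m)).toReal ≤ c * Real.exp (-(m : ℝ) * P + birkhoff φ m x)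

/-- Topological mixing of the Markov shift. -/
def TopMixing {I : Type} (A : I → I → Bool) : Prop :=
  ∀ a b : I, ∃ n₀ : ℕ, ∀ n > n₀, ∃ x ∈ SigmaA A, x 0 = a ∧ x n = b

/-- The big image and preimage property. -/
def BIP {I : Type} (A : I → I → Bool) : Prop :=
  ∃ S : Finset I, ∀ a : I, ∃ b₁ ∈ S, ∃ b₂ ∈ S, ∃ x ∈ SigmaA A,
    x 0 = b₁ ∧ x 1 = a ∧ x 2 = b₂

/-- Partition function over periodic points: `P_n(φ,a) = ∑_{σ^n x = x, x₀ = a} e^{S_n φ (x)}`. -/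
noncomputable def perSum {I : Type} (A : I → I → Bool) (φ : SeqSp I → ℝ) (n : ℕ) (a : I) : ℝ :=
  ∑' x : {x : SeqSp I // x ∈ SigmaA A ∧ shift^[n] x = x ∧ x 0 = a}, Real.exp (birkhoff φ n x.val)

/-- The Gurevich pressure of `φ` is `PG` (the limit exists and is independent of `a`). -/
def HasGurevichPressure {I : Type} (A : I → I → Bool) (φ : SeqSp I → ℝ) (PG : ℝ) : Prop :=
  ∀ a : I, Tendsto (fun n : ℕ => Real.log (perSum A φ n a) / (n : ℝ)) atTop (nhds PG)

/-- `Z_n(t) = ∑_{C ∈ 𝓒_n} μ(C)^{1+t}`. -/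
noncomputable def Zsum {I : Type} [MeasurableSpace I] (A : I → I → Bool) (μ : Measure (SeqSp I))
    (n : ℕ) (t : ℝ) : ℝ :=
  ∑' w : Fin n → I, (μ (cyl A w)).toReal ^ ((1 : ℝ) + t)

/-- The Rényi entropy of `μ` exists and equals `H₂`. -/
def HasRenyi {I : Type} [MeasurableSpace I] (A : I → I → Bool) (μ : Measure (SeqSp I))
    (H₂ : ℝ) : Prop :=
  Tendsto (fun n : ℕ => Real.log (Zsum A μ n 1) / (-(n : ℝ))) atTop (nhds H₂)

/-- `M_n(x)`: the length of the longest common substring appearing twice in the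
first `n` symbols of `x`. -/
noncomputable def Mn {I : Type} (n : ℕ) (x : SeqSp I) : ℕ :=
  sSup {k : ℕ | ∃ i j : ℕ, i < j ∧ j ≤ n - 1 ∧ ∀ m < k, x (i + m) = x (j + m)}

/-- `ψ`-mixing of `μ` (for cylinders) with rate `ψ`. -/
def PsiMixing {I : Type} [MeasurableSpace I] (A : I → I → Bool) (μ : Measure (SeqSp I))
    (ψ : ℕ → ℝ) : Prop :=
  (∀ k, 0 ≤ ψ k) ∧ (∀ j k, j ≤ k → ψ k ≤ ψ j) ∧
    ∀ n k : ℕ, ∀ w : Fin n → I, ∀ m : ℕ, ∀ v : Fin m → I,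
      |(μ (cyl A w ∩ shift^[n + k] ⁻¹' cyl A v)).toReal -
          (μ (cyl A w)).toReal * (μ (cyl A v)).toReal| ≤
        ψ k * (μ (cyl A w)).toReal * (μ (cyl A v)).toReal

/-- Prepending a symbol to a sequence. -/
def consSeq {I : Type} (a : I) (x : SeqSp I) : SeqSp I := fun n => Nat.casesOn n a x

/-- The Ruelle–Perron–Frobenius transfer operator `𝓛_φ f (x) = ∑_{σ y = x} e^{φ(y)} f(y)`. -/
noncomputable def transferOp {I : Type} (A : I → I → Bool) (φ : SeqSp I → ℝ)
    (f : SeqSp I → ℝ) : SeqSp I → ℝ :=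
  fun x => ∑' a : I, if A a (x 0) = true then Real.exp (φ (consSeq a x)) * f (consSeq a x) else 0

open Classical in
/-- The symbolic metric `d(x,y) = e^{-min{j : x_j ≠ y_j}}`. -/
noncomputable def dS {I : Type} (x y : SeqSp I) : ℝ :=
  if x = y then 0 else Real.exp (-((sInf {j : ℕ | x j ≠ y j} : ℕ) : ℝ))

/-- Sup norm over `Σ_A`. -/
noncomputable def supNormOn {I : Type} (A : I → I → Bool) (f : SeqSp I → ℝ) : ℝ :=
  sSup {c : ℝ | ∃ x ∈ SigmaA A, c = |f x|}

/-- The Lipschitz seminorm `D_β` over the sets `σ[a]`, `a ∈ 𝓘`. -/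
noncomputable def DBeta {I : Type} (A : I → I → Bool) (f : SeqSp I → ℝ) : ℝ :=
  sSup {c : ℝ | ∃ a : I, ∃ x ∈ SigmaA A, ∃ y ∈ SigmaA A,
    A a (x 0) = true ∧ A a (y 0) = true ∧ x ≠ y ∧ c = |f x - f y| / dS x y}

/-- The norm `‖f‖_L = ‖f‖_∞ + D_β f`. -/
noncomputable def normL {I : Type} (A : I → I → Bool) (f : SeqSp I → ℝ) : ℝ :=
  supNormOn A f + DBeta A f

lemma splice_mem_SigmaA {I : Type} {A : I → I → Bool} {x y : SeqSp I} (hx : x ∈ SigmaA A)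
    (hy : y ∈ SigmaA A) {p : ℕ} (h : y p = x p) :
    (fun i => if i ≤ p then x i else y i) ∈ SigmaA A := by
  intro i
  rcases lt_trichotomy i p with hi | rfl | hi
  · simpa [hi.le, Nat.succ_le_of_lt hi] using hx i
  · simpa [← h] using hy i
  · simpa [not_le.2 hi, not_le.2 (hi.trans (Nat.lt_succ_self i))] using hy i

section Saturation

variable {I J : Type} [MeasurableSpace I]

/-- A map `q` whose fibres are not split by any measurable set. -/
def Unsplit (q : I → J) : Prop :=
  ∀ a b, q a = q b → ∀ s, MeasurableSet s → (a ∈ s ↔ b ∈ s)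

lemma Unsplit.mem_iff {q : I → J} (hq : Unsplit q) {U : Set (SeqSp I)} (hU : MeasurableSet U)
    {y z : SeqSp I} (h : ∀ i, q (y i) = q (z i)) : y ∈ U ↔ z ∈ U := by
  have key : MeasurableSpace.pi ≤
      (MeasurableSpace.mk (fun U : Set (SeqSp I) => y ∈ U ↔ z ∈ U) (by simp)
        (fun s hs => by simp only [Set.mem_compl_iff]; exact not_congr hs)
        (fun f hf => by simp only [Set.mem_iUnion]; exact exists_congr hf)) := by
    refine iSup_le fun i => ?_
    rintro _ ⟨s, hs, rfl⟩
    exact hq _ _ (h i) s hs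
  exact key U hU

lemma Unsplit.measure_le {q : I → J} (hq : Unsplit q) {μ : Measure (SeqSp I)}
    {S T : Set (SeqSp I)} (h : ∀ y ∈ S, ∃ z ∈ T, ∀ i, q (y i) = q (z i)) : μ S ≤ μ T := by
  rw [← measure_toMeasurable T]
  refine measure_mono fun y hy => ?_
  obtain ⟨z, hz, hyz⟩ := h y hy
  exact (hq.mem_iff (measurableSet_toMeasurable μ T) hyz).2 (subset_toMeasurable μ T hz)

/-- The saturation of a cylinder is determined by the classes of its letters and by its last
letter. -/
lemma Unsplit.measure_le_cylAt {q : I → J} (hq : Unsplit q) {A : I → I → Bool}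
    {μ : Measure (SeqSp I)} {x : SeqSp I} (hx : x ∈ SigmaA A) (p : ℕ) :
    μ {y | y ∈ SigmaA A ∧ (∀ i ≤ p, q (y i) = q (x i)) ∧ y p = x p} ≤ μ (cylAt A x (p + 1)) := by
  refine hq.measure_le ?_
  rintro y ⟨hy, hyx, hp⟩
  refine ⟨_, ⟨splice_mem_SigmaA hx hy hp, fun i hi => by simp [Nat.lt_succ_iff.1 hi]⟩, fun i => ?_⟩
  by_cases hi : i ≤ p
  · simp [hi, hyx i hi]
  · simp [hi]

lemma measure_eq_measure_SigmaA_inter {A : I → I → Bool} {μ : Measure (SeqSp I)}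
    [IsProbabilityMeasure μ] (hsupp : μ (SigmaA A) = 1) {E : Set (SeqSp I)}
    (hE : MeasurableSet E) : μ E = μ (SigmaA A ∩ E) := by
  rw [← Measure.measure_toMeasurable_inter hE (measure_ne_top μ _), Set.inter_comm]
  have hT : toMeasurable μ (SigmaA A) ∈ ae μ :=
    (mem_ae_iff_prob_eq_one (measurableSet_toMeasurable _ _)).2 (by rw [measure_toMeasurable, hsupp])
  refine measure_congr ?_
  filter_upwards [hT] with x hx
  exact propext ⟨fun h => ⟨h, hx⟩, fun h => h.1⟩

end Saturation

lemma shift_iterate_apply {I : Type} (x : SeqSp I) (k i : ℕ) : shift^[k] x i = x (i + k) := by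
  induction k generalizing x with
  | zero => rfl
  | succ k ih => rw [Function.iterate_succ_apply, ih]; simp [shift, add_assoc]

lemma shift_iterate_mem_SigmaA {I : Type} {A : I → I → Bool} {x : SeqSp I} (hx : x ∈ SigmaA A)
    (k : ℕ) : shift^[k] x ∈ SigmaA A := by
  intro i
  have := hx (i + k)
  rwa [shift_iterate_apply, shift_iterate_apply, add_right_comm]

lemma cylAt_eq_cyl {I : Type} (A : I → I → Bool) (x : SeqSp I) (k : ℕ) :
    cylAt A x k = cyl A (fun i : Fin k => x i) := by
  ext y
  exact and_congr_right fun _ => ⟨fun h i => h i i.2, fun h i hi => h ⟨i, hi⟩⟩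

section Gibbs

open scoped ENNReal

variable {I : Type}

/-- The weight `exp (-m P + S_m φ)` as an extended nonnegative real. -/
noncomputable def gibbsWeight (φ : SeqSp I → ℝ) (P : ℝ) (m : ℕ) (x : SeqSp I) : ℝ≥0∞ :=
  ENNReal.ofReal (Real.exp (-(m : ℝ) * P + birkhoff φ m x))

lemma birkhoff_add (φ : SeqSp I → ℝ) (m n : ℕ) (x : SeqSp I) :
    birkhoff φ (m + n) x = birkhoff φ m x + birkhoff φ n (shift^[m] x) := by
  simp only [birkhoff, Finset.sum_range_add, ← Function.iterate_add_apply, add_comm]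

lemma gibbsWeight_add (φ : SeqSp I → ℝ) (P : ℝ) (m n : ℕ) (x : SeqSp I) :
    gibbsWeight φ P (m + n) x = gibbsWeight φ P m x * gibbsWeight φ P n (shift^[m] x) := by
  rw [gibbsWeight, gibbsWeight, gibbsWeight, ← ENNReal.ofReal_mul (Real.exp_nonneg _),
    ← Real.exp_add, birkhoff_add]
  congr 2
  push_cast
  ring

lemma gibbsWeight_eq_prod (φ : SeqSp I → ℝ) (P : ℝ) (m : ℕ) (x : SeqSp I) :
    gibbsWeight φ P m x = ∏ i : Fin m, gibbsWeight φ P 1 (shift^[i] x) := by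
  induction m with
  | zero => simp [gibbsWeight, birkhoff]
  | succ m ih => rw [gibbsWeight_add, ih, Fin.prod_univ_castSucc]; simp

lemma IsGibbs.exists_gibbsWeight [MeasurableSpace I] {A : I → I → Bool} {φ : SeqSp I → ℝ}
    {μ : Measure (SeqSp I)} [IsProbabilityMeasure μ] (h : IsGibbs A φ μ) :
    ∃ c : ℝ≥0∞, c ≠ ∞ ∧ ∃ P : ℝ, ∀ x ∈ SigmaA A, ∀ m : ℕ,
      μ (cylAt A x m) ≤ c * gibbsWeight φ P m x ∧ gibbsWeight φ P m x ≤ c * μ (cylAt A x m) := by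
  obtain ⟨c, hc, P, h⟩ := h
  refine ⟨ENNReal.ofReal c, ENNReal.ofReal_ne_top, P, fun x hx m => ?_⟩
  obtain ⟨h1, h2⟩ := h x hx m
  have hm : μ (cylAt A x m) = ENNReal.ofReal (μ (cylAt A x m)).toReal :=
    (ENNReal.ofReal_toReal (measure_ne_top _ _)).symm
  rw [hm, gibbsWeight, ← ENNReal.ofReal_mul hc.le, ← ENNReal.ofReal_mul hc.le]
  refine ⟨ENNReal.ofReal_le_ofReal h2, ENNReal.ofReal_le_ofReal ?_⟩
  rwa [← inv_mul_le_iff₀ hc]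

end Gibbs

section Words

variable {I J : Type}

/-- The points at which a word of length `k`, up to `q`, recurs after time `l`. -/
def repSet (q : I → J) (k l : ℕ) : Set (SeqSp I) := {x | ∀ m < k, q (x m) = q (x (l + m))}

/-- The points whose letters lie infinitely often in the classes `F`. -/
def visitSet (q : I → J) (F : Set J) : Set (SeqSp I) := {x | ∀ N, ∃ i, q (x (N + i)) ∈ F}

lemma apply_add_mul_of_mem_repSet {q : I → J} {k l : ℕ} {x : SeqSp I} (hx : x ∈ repSet q k l)
    (t : ℕ) {m : ℕ} (hm : m + t * l < k + l) : q (x m) = q (x (t * l + m)) := by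
  induction t with
  | zero => simp
  | succ t ih =>
    rw [add_mul, one_mul] at hm ⊢
    rw [ih (by omega), hx (t * l + m) (by omega)]
    congr 2
    ring

/-- A self-overlapping repetition contains a non-overlapping one of half the length. -/
lemma exists_repSet_subset_half (q : I → J) {k l : ℕ} (hl : 1 ≤ l) :
    ∃ l', (k + 1) / 2 ≤ l' ∧ repSet q k l ⊆ repSet q ((k + 1) / 2) l' := by
  set h := (k + 1) / 2 with hh
  have h1 : (h + l - 1) / l * l ≤ h + l - 1 := Nat.div_mul_le_self _ _
  have h2 : h + l - 1 < (h + l - 1) / l * l + l := Nat.lt_div_mul_add hl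
  refine ⟨(h + l - 1) / l * l, by omega, fun x hx m hm => ?_⟩
  exact apply_add_mul_of_mem_repSet hx _ (by omega)

lemma shift_iterate_mem_visitSet {q : I → J} {F : Set J} {x : SeqSp I} (hx : x ∈ visitSet q F)
    (i : ℕ) : shift^[i] x ∈ visitSet q F := by
  intro N
  obtain ⟨j, hj⟩ := hx (N + i)
  refine ⟨j, ?_⟩
  rwa [shift_iterate_apply, add_right_comm]

/-- The points with a repetition, up to `q`, of length `k` starting at two times below `n`. -/
def matchSet (q : I → J) (n k : ℕ) : Set (SeqSp I) :=
  {x | ∃ i l, 1 ≤ l ∧ i + l < n ∧ shift^[i] x ∈ repSet q k l}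

lemma Mn_le_of_notMem_matchSet (q : I → J) {x : SeqSp I} {n N k : ℕ} (hn : 0 < n) (hnN : n ≤ N)
    (hx : x ∉ matchSet q N (k + 1)) : Mn n x ≤ k := by
  refine csSup_le' ?_
  rintro k' ⟨i, j, hij, hj, h⟩
  by_contra hk
  refine hx ⟨i, j - i, by omega, by omega, fun m hm => ?_⟩
  rw [shift_iterate_apply, shift_iterate_apply, add_comm m, h m (by omega)]
  congr 2
  omega

end Words

section Repetition

open scoped ENNReal

lemma repetition_bound_le {a r : ℝ} (ha : 0 < a) (hr : 0 < r)
    (hρ : 2 * Real.exp (-(a * Real.log 2 * r / 2)) ≤ 1) (j k : ℕ)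
    (hk : a * (j * Real.log 2) ≤ k) (hk' : k ≤ a * (j * Real.log 2) + 1) :
    (2 : ℝ) ^ (j + 1) * (k * Real.exp (-(((k + 1) / 2 : ℕ) * r))
        + 2 ^ (j + 1) * Real.exp (-(k * r)))
      ≤ (2 * a * j + 6) * (2 * Real.exp (-(a * Real.log 2 * r / 2))) ^ j := by
  have hpow := pow_le_one₀ (n := j) (by positivity) hρ
  rw [mul_pow] at hpow ⊢
  set y := Real.exp (-(a * Real.log 2 * r / 2)) ^ j with hy
  have hy' : y = Real.exp (-(a * (j * Real.log 2) * r / 2)) := by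
    rw [hy, ← Real.exp_nat_mul]
    ring_nf
  have hhalf : (k : ℝ) / 2 ≤ ((k + 1) / 2 : ℕ) := by
    rw [div_le_iff₀ two_pos]
    exact_mod_cast (show k ≤ (k + 1) / 2 * 2 by omega)
  have h1 : Real.exp (-(((k + 1) / 2 : ℕ) * r)) ≤ y := by
    rw [hy', Real.exp_le_exp]
    nlinarith
  have h2 : Real.exp (-(k * r)) ≤ y ^ 2 := by
    rw [hy', ← Real.exp_nat_mul, Real.exp_le_exp]
    push_cast
    nlinarith
  have hk'' : (k : ℝ) ≤ a * j + 1 := by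
    have h3 : Real.log 2 ≤ 1 := (Real.log_two_lt_d9.trans (by norm_num)).le
    have h4 : a * (j * Real.log 2) ≤ a * (j * 1) := by gcongr
    linarith
  have hy0 : 0 ≤ y := by positivity
  calc (2 : ℝ) ^ (j + 1) * (k * Real.exp (-(((k + 1) / 2 : ℕ) * r))
        + 2 ^ (j + 1) * Real.exp (-(k * r)))
      ≤ (2 : ℝ) ^ (j + 1) * ((a * j + 1) * y + 2 ^ (j + 1) * y ^ 2) := by gcongr
    _ = (2 * a * j + 2) * (2 ^ j * y) + 4 * (2 ^ j * y) * (2 ^ j * y) := by ring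
    _ ≤ (2 * a * j + 2) * (2 ^ j * y) + 4 * (2 ^ j * y) * 1 := by gcongr
    _ = _ := by ring

lemma ENNReal.tsum_pi_prod {J : Type} (p : J → ℝ≥0∞) (t : ℕ) :
    ∑' u : Fin t → J, ∏ i, p (u i) = (∑' j, p j) ^ t := by
  induction t with
  | zero => simp
  | succ t ih =>
    rw [← (Fin.consEquiv fun _ => J).tsum_eq, ENNReal.tsum_prod', pow_succ', ← ih,
      ← ENNReal.tsum_mul_right]
    refine tsum_congr fun j => ?_
    rw [← ENNReal.tsum_mul_left]
    exact tsum_congr fun u => by simp [Fin.consEquiv, Fin.prod_univ_succ]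

variable {I J : Type} [MeasurableSpace I]

/-- The sum of the squared outer measures of the `k`-cylinders. -/
noncomputable def sqSum (A : I → I → Bool) (μ : Measure (SeqSp I)) (k : ℕ) : ℝ≥0∞ :=
  ∑' w : Fin k → I, μ (cyl A w) ^ 2

lemma finite_fibre_of_sqSum_ne_top {q : I → J} (hq : Unsplit q)
    {A : I → I → Bool} (hbip : BIP A) {φ : SeqSp I → ℝ} {μ : Measure (SeqSp I)}
    {c : ℝ≥0∞} {P : ℝ}
    (hG : ∀ x ∈ SigmaA A, ∀ m : ℕ,
      μ (cylAt A x m) ≤ c * gibbsWeight φ P m x ∧ gibbsWeight φ P m x ≤ c * μ (cylAt A x m))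
    {n : ℕ} (hn : 2 ≤ n) (hZ : sqSum A μ n ≠ ∞) (j : J) : (q ⁻¹' {j}).Finite := by
  classical
  obtain ⟨S, hS⟩ := hbip
  set B : I → Set I := fun s => {a | q a = j ∧ ∃ x ∈ SigmaA A, x 0 = a ∧ x 1 = s}
  refine (S.finite_toSet.biUnion (t := B) fun s _ => ?_).subset fun a ha => ?_
  swap
  · obtain ⟨-, -, s, hs, x, hx, -, h1, h2⟩ := hS a
    refine Set.mem_biUnion hs ⟨ha, shift^[1] x, shift_iterate_mem_SigmaA hx 1, ?_, ?_⟩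
    · rwa [shift_iterate_apply]
    · rwa [shift_iterate_apply]
  by_contra hinf
  have : Infinite (B s) := Set.infinite_coe_iff.2 hinf
  obtain ⟨a₀, ha₀, y, hy, hy0, hy1⟩ := (Set.not_finite.1 hinf : (B s).Infinite).nonempty
  have hupd : ∀ a ∈ B s, ∀ z ∈ SigmaA A, z 1 = s → Function.update z 0 a ∈ SigmaA A := by
    rintro a ⟨-, x, hx, rfl, hx1⟩ z hz hz1 i
    rcases i with _ | i
    · simpa [hz1, ← hx1] using hx 0
    · simpa using hz (i + 1)
  have hle : ∀ a : B s, μ (cylAt A y n) ≤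
      μ (cyl A fun i : Fin n => Function.update y 0 (a : I) i) := by
    rintro ⟨a, ha⟩
    rw [← cylAt_eq_cyl]
    refine hq.measure_le ?_
    rintro z ⟨hz, hzy⟩
    refine ⟨Function.update z 0 a, ⟨hupd a ha z hz ((hzy 1 (by omega)).trans hy1), ?_⟩, ?_⟩
    · rintro (_ | i) hi
      · simp
      · simpa using hzy _ hi
    · rintro (_ | i)
      · rw [Function.update_self, hzy 0 (by omega), hy0, ha.1, ha₀]
      · simp
  have hpos : μ (cylAt A y n) ^ 2 ≠ 0 := by
    refine pow_ne_zero 2 fun h0 => ?_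
    have h := (hG y hy n).2
    rw [h0, mul_zero, gibbsWeight, nonpos_iff_eq_zero, ENNReal.ofReal_eq_zero] at h
    exact absurd h (not_le.2 (Real.exp_pos _))
  have hinj : Function.Injective
      fun (a : B s) (i : Fin n) => Function.update y 0 (a : I) (i : ℕ) := by
    intro a a' h
    simpa using Subtype.ext (by simpa using congrFun h ⟨0, by omega⟩)
  refine hZ (top_le_iff.1 ?_)
  calc (∞ : ℝ≥0∞) = ∑' _ : B s, μ (cylAt A y n) ^ 2 :=
        (ENNReal.tsum_const_eq_top_of_ne_zero hpos).symm
    _ ≤ ∑' a : B s, μ (cyl A fun i : Fin n => Function.update y 0 (a : I) i) ^ 2 :=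
        ENNReal.tsum_le_tsum fun a => pow_le_pow_left₀ zero_le (hle a) 2
    _ ≤ sqSum A μ n :=
        ENNReal.tsum_comp_le_tsum_of_injective hinj fun w => μ (cyl A w) ^ 2

lemma HasRenyi.eventually_sqSum_le {A : I → I → Bool} {μ : Measure (SeqSp I)}
    [IsProbabilityMeasure μ] {H₂ r : ℝ} (h : HasRenyi A μ H₂) (hr : 0 < r) (hrH : r < H₂) :
    ∀ᶠ k in atTop, sqSum A μ k ≤ ENNReal.ofReal (Real.exp (-(k * r))) := by
  filter_upwards [h.eventually_const_lt hrH, eventually_gt_atTop 0] with k hk hk0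
  have hk0' : (0 : ℝ) < k := Nat.cast_pos.2 hk0
  rw [div_neg, lt_neg, div_lt_iff₀ hk0'] at hk
  have hlog : Real.log (Zsum A μ k 1) < 0 := hk.trans (by nlinarith)
  have hterm : ∀ w : Fin k → I, (μ (cyl A w)).toReal ^ ((1 : ℝ) + 1) = (μ (cyl A w)).toReal ^ 2 :=
    fun w => by rw [← Real.rpow_natCast]; norm_num
  have hZ : Zsum A μ k 1 = ∑' w : Fin k → I, (μ (cyl A w)).toReal ^ 2 := tsum_congr hterm
  rw [hZ] at hk hlog
  have hsum : Summable fun w : Fin k → I => (μ (cyl A w)).toReal ^ 2 := by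
    by_contra hns
    simp [tsum_eq_zero_of_not_summable hns] at hlog
  have hZpos : 0 < ∑' w : Fin k → I, (μ (cyl A w)).toReal ^ 2 := by
    refine (tsum_nonneg fun w => sq_nonneg _).lt_of_ne fun h0 => ?_
    simp [← h0] at hlog
  have : sqSum A μ k = ENNReal.ofReal (∑' w : Fin k → I, (μ (cyl A w)).toReal ^ 2) := by
    rw [ENNReal.ofReal_tsum_of_nonneg (fun w => sq_nonneg _) hsum, sqSum]
    refine tsum_congr fun w => ?_
    rw [ENNReal.ofReal_pow ENNReal.toReal_nonneg, ENNReal.ofReal_toReal (measure_ne_top _ _)]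
  rw [this]
  refine ENNReal.ofReal_le_ofReal ?_
  rw [← Real.log_le_iff_le_exp hZpos]
  linarith

lemma measure_matchSet_inter_le {q : I → J} {μ : Measure (SeqSp I)}
    (hinv : MeasurePreserving (shift : SeqSp I → SeqSp I) μ μ) {F : Set J} {Z : ℕ → ℝ≥0∞}
    (hZ : ∀ k l, k ≤ l → μ (repSet q k l ∩ visitSet q F) ≤ Z k) (n k : ℕ) :
    μ (matchSet q n k ∩ visitSet q F) ≤ n * (k * Z ((k + 1) / 2) + n * Z k) := by
  set E : ℕ → Set (SeqSp I) := fun l => repSet q k l ∩ visitSet q F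
  calc _ ≤ μ (⋃ i ∈ Finset.range n, shift^[i] ⁻¹'
          ((⋃ l ∈ Finset.Ico 1 k, E l) ∪ ⋃ l ∈ Finset.Ico k n, E l)) := by
        refine measure_mono ?_
        rintro x ⟨⟨i, l, hl, hil, hx⟩, hxv⟩
        simp only [Set.mem_iUnion]
        refine ⟨i, Finset.mem_range.2 (by omega), ?_⟩
        have hxE : shift^[i] x ∈ E l := ⟨hx, shift_iterate_mem_visitSet hxv i⟩
        rcases lt_or_ge l k with h | h
        · exact Or.inl (Set.mem_biUnion (Finset.mem_Ico.2 ⟨hl, h⟩) hxE)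
        · exact Or.inr (Set.mem_biUnion (Finset.mem_Ico.2 ⟨h, by omega⟩) hxE)
    _ ≤ ∑ i ∈ Finset.range n, (k * Z ((k + 1) / 2) + n * Z k) := by
        refine (measure_biUnion_finset_le _ _).trans (Finset.sum_le_sum fun i _ => ?_)
        refine ((hinv.iterate i).measure_preimage_le _).trans ((measure_union_le _ _).trans ?_)
        refine add_le_add ((measure_biUnion_finset_le _ _).trans ?_)
          ((measure_biUnion_finset_le _ _).trans ?_)
        · refine (Finset.sum_le_card_nsmul _ _ (Z ((k + 1) / 2)) fun l hl => ?_).trans ?_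
          · obtain ⟨l', hl', hsub⟩ := exists_repSet_subset_half q (k := k) (Finset.mem_Ico.1 hl).1
            exact (measure_mono (Set.inter_subset_inter_left _ hsub)).trans (hZ _ _ hl')
          · rw [nsmul_eq_mul]
            gcongr
            simp
        · refine (Finset.sum_le_card_nsmul _ _ (Z k) fun l hl =>
            hZ _ _ (Finset.mem_Ico.1 hl).1).trans ?_
          rw [nsmul_eq_mul]
          gcongr
          simp
    _ = _ := by rw [Finset.sum_const, Finset.card_range, nsmul_eq_mul]

lemma ae_eventually_Mn_le {q : I → J} {A : I → I → Bool} {μ : Measure (SeqSp I)}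
    (hinv : MeasurePreserving (shift : SeqSp I → SeqSp I) μ μ) {F : Set J} {K : ℝ≥0∞}
    (hK : K ≠ ∞)
    (hZ : ∀ k l, k ≤ l → μ (repSet q k l ∩ visitSet q F) ≤ K * sqSum A μ k) {a r : ℝ}
    (ha : 0 < a) (hr : 0 < r) (har : 2 < a * r)
    (hdecay : ∀ᶠ k in atTop, sqSum A μ k ≤ ENNReal.ofReal (Real.exp (-(k * r)))) :
    ∀ᵐ x ∂μ, x ∈ visitSet q F → ∀ᶠ n : ℕ in atTop, (Mn n x : ℝ) ≤ a * Real.log n := by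
  have hlog2 : 0 < Real.log 2 := Real.log_pos one_lt_two
  set κ : ℕ → ℕ := fun j => ⌊a * (j * Real.log 2)⌋₊ with hκ
  set s : ℕ → Set (SeqSp I) := fun j => matchSet q (2 ^ (j + 1)) (κ j + 1) ∩ visitSet q F
  set ρ := 2 * Real.exp (-(a * Real.log 2 * r / 2)) with hρ
  have hρ0 : 0 ≤ ρ := by positivity
  have hρ1 : ρ < 1 := by
    have h : ρ = Real.exp (Real.log 2 + -(a * Real.log 2 * r / 2)) := by
      rw [Real.exp_add, Real.exp_log two_pos]
    rw [h, Real.exp_lt_one_iff]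
    nlinarith
  have hκ_top : Tendsto κ atTop atTop :=
    tendsto_nat_floor_atTop.comp
      ((tendsto_natCast_atTop_atTop.atTop_mul_const hlog2).const_mul_atTop ha)
  obtain ⟨k₀, hk₀⟩ := eventually_atTop.1 hdecay
  obtain ⟨j₀, hj₀⟩ := eventually_atTop.1 (hκ_top.eventually_ge_atTop (2 * k₀))
  have hs : ∀ j ≥ j₀, μ (s j) ≤ K * ENNReal.ofReal ((2 * a * j + 6) * ρ ^ j) := by
    intro j hj
    have hkj := hj₀ j hj
    have hfloor : (κ j : ℝ) ≤ a * (j * Real.log 2) := Nat.floor_le (by positivity)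
    have hfloor' : a * (j * Real.log 2) < κ j + 1 := Nat.lt_floor_add_one _
    refine (measure_matchSet_inter_le hinv hZ _ _).trans ?_
    calc _ ≤ ((2 ^ (j + 1) : ℕ) : ℝ≥0∞) * ((κ j + 1 : ℕ) *
            (K * ENNReal.ofReal (Real.exp (-(((κ j + 1 + 1) / 2 : ℕ) * r))))
            + (2 ^ (j + 1) : ℕ) * (K * ENNReal.ofReal (Real.exp (-((κ j + 1 : ℕ) * r))))) := by
          gcongr
          · exact hk₀ _ (by omega)
          · exact hk₀ _ (by omega)
      _ = K * ENNReal.ofReal ((2 : ℝ) ^ (j + 1) *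
            ((κ j + 1 : ℕ) * Real.exp (-(((κ j + 1 + 1) / 2 : ℕ) * r))
              + 2 ^ (j + 1) * Real.exp (-((κ j + 1 : ℕ) * r)))) := by
          rw [ENNReal.ofReal_mul (by positivity), ENNReal.ofReal_add (by positivity)
            (by positivity), ENNReal.ofReal_mul (by positivity), ENNReal.ofReal_mul (by positivity),
            ENNReal.ofReal_natCast, ENNReal.ofReal_pow (by norm_num), ENNReal.ofReal_ofNat]
          push_cast
          ring
      _ ≤ _ := by
          refine mul_le_mul_right (ENNReal.ofReal_le_ofReal ?_) K
          exact repetition_bound_le ha hr hρ1.le j (κ j + 1) (by push_cast; exact hfloor'.le)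
            (by push_cast; linarith)
  have hsum : Summable fun j : ℕ => (2 * a * j + 6) * ρ ^ j := by
    have h1 := summable_pow_mul_geometric_of_norm_lt_one 1
      (show ‖ρ‖ < 1 by rwa [Real.norm_of_nonneg hρ0])
    have h2 := summable_geometric_of_lt_one hρ0 hρ1
    refine ((h1.mul_left (2 * a)).add (h2.mul_left 6)).congr fun j => ?_
    ring
  have hfin : ∑' j, μ (s (j + j₀)) ≠ ∞ := by
    refine ne_top_of_le_ne_top ?_ (ENNReal.tsum_le_tsum fun j => hs _ (Nat.le_add_left _ _))
    rw [ENNReal.tsum_mul_left]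
    exact ENNReal.mul_ne_top hK ((summable_nat_add_iff j₀).2 hsum).tsum_ofReal_ne_top
  filter_upwards [ae_eventually_notMem hfin] with x hx hxv
  obtain ⟨j₁, hj₁⟩ := eventually_atTop.1 hx
  filter_upwards [eventually_ge_atTop (2 ^ (j₁ + j₀))] with n hn
  have hn0 : n ≠ 0 := (lt_of_lt_of_le (by positivity) hn).ne'
  have hj : j₁ + j₀ ≤ Nat.log 2 n := (Nat.le_log_iff_pow_le one_lt_two hn0).2 hn
  set j := Nat.log 2 n with hj_def
  have hnot : x ∉ matchSet q (2 ^ (j + 1)) (κ j + 1) := fun h => by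
    have := hj₁ (j - j₀) (by omega)
    rw [Nat.sub_add_cancel (by omega)] at this
    exact this ⟨h, hxv⟩
  calc (Mn n x : ℝ) ≤ κ j := Nat.cast_le.2 (Mn_le_of_notMem_matchSet q (Nat.pos_of_ne_zero hn0)
        (Nat.lt_pow_succ_log_self one_lt_two n).le hnot)
    _ ≤ a * (j * Real.log 2) := Nat.floor_le (by positivity)
    _ ≤ a * Real.log n := by
        gcongr
        rw [← Real.log_pow]
        refine Real.log_le_log (by positivity) ?_
        exact_mod_cast Nat.pow_log_le_self 2 hn0

variable [MeasurableSpace J] [MeasurableSingletonClass J]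

lemma tsum_classCyl_le_one {q : I → J} (hqm : Measurable q) (μ : Measure (SeqSp I))
    [IsProbabilityMeasure μ] (d : ℕ) :
    ∑' u : Fin d → J, μ {y | ∀ m : Fin d, q (y m) = u m} ≤ 1 := by
  refine (tsum_meas_le_meas_iUnion_of_disjoint μ (fun u => ?_) fun u v huv => ?_).trans prob_le_one
  · rw [Set.ofPred_forall]
    exact MeasurableSet.iInter fun m =>
      (hqm.comp (measurable_pi_apply _)) (measurableSet_singleton (u m))
  · refine Set.disjoint_left.2 fun y hu hv => huv ?_
    funext m
    exact (hu m).symm.trans (hv m)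

variable [Countable J]

lemma measure_repSet_inter_firstVisit_le {q : I → J} (hqm : Measurable q) (hq : Unsplit q)
    {A : I → I → Bool} {φ : SeqSp I → ℝ} {μ : Measure (SeqSp I)} [IsProbabilityMeasure μ]
    {c : ℝ≥0∞} {P : ℝ}
    (hG : ∀ x ∈ SigmaA A, ∀ m : ℕ,
      μ (cylAt A x m) ≤ c * gibbsWeight φ P m x ∧ gibbsWeight φ P m x ≤ c * μ (cylAt A x m))
    (F : Set J) (k d t : ℕ) (b : I) :
    μ {x | x ∈ SigmaA A ∧ x ∈ repSet q k (k + d) ∧ (∀ i < t, q (x (k + d + k + i)) ∉ F) ∧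
        x (k + d + k + t) = b}
      ≤ c ^ 5 * sqSum A μ k * (c * μ {x | q (x 0) ∉ F}) ^ t := by
  classical
  set z : (Fin k → J) → ℝ≥0∞ := fun v =>
    ∑' w : Fin k → I, if (fun i => q (w i)) = v then μ (cyl A w) ^ 2 else 0 with hz
  set ν : (Fin d → J) → ℝ≥0∞ := fun u => μ {y | ∀ m : Fin d, q (y m) = u m} with hν
  set p : J → ℝ≥0∞ := fun j => if j ∈ F then 0 else μ {y | q (y 0) = j} with hp
  set T : (Fin k → J) × (Fin d → J) × (Fin t → J) → Set (SeqSp I) := fun a =>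
    {x | x ∈ SigmaA A ∧ x ∈ repSet q k (k + d) ∧ (∀ i < t, q (x (k + d + k + i)) ∉ F) ∧
        x (k + d + k + t) = b ∧ (∀ i : Fin k, q (x i) = a.1 i) ∧
        (∀ i : Fin d, q (x (k + i)) = a.2.1 i) ∧
        ∀ i : Fin t, q (x (k + d + k + i)) = a.2.2 i} with hT
  have hz_sum : ∑' v, z v = sqSum A μ k := by
    rw [hz, ENNReal.tsum_comm, sqSum]
    exact tsum_congr fun w => tsum_ite_eq' _ _
  have hp_sum : ∑' j, p j ≤ μ {x | q (x 0) ∉ F} := by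
    refine le_trans (le_of_eq (tsum_congr fun j => ?_)) (le_trans
      (tsum_meas_le_meas_iUnion_of_disjoint μ
        (As := fun j => {y : SeqSp I | q (y 0) = j ∧ j ∉ F}) (fun j => ?_) fun j j' hj => ?_)
      (measure_mono ?_))
    · by_cases hj : j ∈ F <;> simp [hp, hj]
    · refine MeasurableSet.inter ?_ (MeasurableSet.const _)
      exact (hqm.comp (measurable_pi_apply 0)) (measurableSet_singleton j)
    · exact Set.disjoint_left.2 fun y hy hy' => hj (hy.1.symm.trans hy'.1)
    · intro y hy
      obtain ⟨j, hj, hjF⟩ := Set.mem_iUnion.1 hy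
      exact fun h => hjF (hj ▸ h)
  have hcyl : ∀ x ∈ SigmaA A, ∀ i m, gibbsWeight φ P m (shift^[i] x)
      ≤ c * μ (cylAt A (shift^[i] x) m) := fun x hx i m =>
    (hG _ (shift_iterate_mem_SigmaA hx i) m).2
  have hz_le : ∀ (x : SeqSp I) (v : Fin k → J), (∀ i : Fin k, q (x i) = v i) →
      μ (cylAt A x k) ^ 2 ≤ z v := by
    intro x v hv
    rw [cylAt_eq_cyl]
    refine le_trans (le_of_eq ?_) (ENNReal.le_tsum fun i : Fin k => x i)
    rw [if_pos (funext hv)]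
  have hT_le : ∀ a, μ (T a) ≤ c ^ 5 * (z a.1 * (ν a.2.1 * ∏ i, c * p (a.2.2 i))) := by
    rintro ⟨v, u, u'⟩
    rcases (T (v, u, u')).eq_empty_or_nonempty with h0 | ⟨x, hx, hxr, hxF, hxb, hxv, hxu, hxu'⟩
    · simp [h0]
    dsimp only at hxv hxu hxu' ⊢
    have h1 : μ (T (v, u, u')) ≤ μ (cylAt A x (k + d + k + t + 1)) := by
      refine (measure_mono ?_).trans (hq.measure_le_cylAt hx _)
      rintro y ⟨hy, hyr, hyF, hyb, hyv, hyu, hyu'⟩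
      refine ⟨hy, fun i hi => ?_, hyb.trans hxb.symm⟩
      dsimp only at hyv hyu hyu'
      by_cases h1 : i < k
      · exact (hyv ⟨i, h1⟩).trans (hxv ⟨i, h1⟩).symm
      by_cases h2 : i < k + d
      · obtain ⟨j, rfl⟩ := Nat.exists_eq_add_of_le (not_lt.1 h1)
        have hj : j < d := by omega
        exact (hyu ⟨j, hj⟩).trans (hxu ⟨j, hj⟩).symm
      by_cases h3 : i < k + d + k
      · obtain ⟨j, rfl⟩ := Nat.exists_eq_add_of_le (not_lt.1 h2)
        have hj : j < k := by omega
        rw [← hyr j hj, ← hxr j hj]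
        exact (hyv ⟨j, hj⟩).trans (hxv ⟨j, hj⟩).symm
      obtain ⟨j, rfl⟩ := Nat.exists_eq_add_of_le (not_lt.1 h3)
      rcases (show j < t ∨ j = t by omega) with hj | rfl
      · exact (hyu' ⟨j, hj⟩).trans (hxu' ⟨j, hj⟩).symm
      · rw [hyb, hxb]
    have hsq : μ (cylAt A x k) * μ (cylAt A (shift^[k + d] x) k) ≤ z v := by
      have ha := hz_le x v hxv
      have hb := hz_le (shift^[k + d] x) v fun i => by
        rw [shift_iterate_apply, add_comm, ← hxr i i.2, hxv]
      rcases le_total (μ (cylAt A x k)) (μ (cylAt A (shift^[k + d] x) k)) with h | h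
      · exact (mul_le_mul_left h _).trans ((sq _).symm.le.trans hb)
      · exact (mul_le_mul_right h _).trans ((sq _).symm.le.trans ha)
    have hu : μ (cylAt A (shift^[k] x) d) ≤ ν u := by
      refine measure_mono fun y hy m => ?_
      rw [hy.2 m m.2, shift_iterate_apply, add_comm, hxu]
    have hu' : gibbsWeight φ P t (shift^[k + d + k] x) ≤ ∏ i, c * p (u' i) := by
      rw [gibbsWeight_eq_prod]
      refine Finset.prod_le_prod' fun i _ => ?_
      rw [← Function.iterate_add_apply]
      refine (hcyl x hx _ 1).trans (mul_le_mul_right ?_ c)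
      have hF : u' i ∉ F := by rw [← hxu' i]; exact hxF i i.2
      simp only [hp, if_neg hF]
      refine measure_mono fun y hy => ?_
      simp only [Set.mem_ofPred_eq]
      rw [hy.2 0 one_pos, shift_iterate_apply, ← hxu' i, zero_add, add_comm]
    calc μ (T (v, u, u'))
        ≤ c * gibbsWeight φ P (k + d + k + t + 1) x := h1.trans (hG x hx _).1
      _ = c * (gibbsWeight φ P k x * gibbsWeight φ P d (shift^[k] x)
            * gibbsWeight φ P k (shift^[k + d] x) * gibbsWeight φ P t (shift^[k + d + k] x)
            * gibbsWeight φ P 1 (shift^[k + d + k + t] x)) := by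
          simp only [gibbsWeight_add]
      _ ≤ c * ((c * μ (cylAt A x k)) * (c * ν u)
            * (c * μ (cylAt A (shift^[k + d] x) k)) * (∏ i, c * p (u' i)) * (c * 1)) := by
          gcongr
          · exact hcyl x hx 0 k
          · exact (hcyl x hx k d).trans (mul_le_mul_right hu c)
          · exact hcyl x hx _ k
          · exact (hcyl x hx _ 1).trans (mul_le_mul_right prob_le_one c)
      _ = c ^ 5 * ((μ (cylAt A x k) * μ (cylAt A (shift^[k + d] x) k))
            * (ν u * ∏ i, c * p (u' i))) := by ring
      _ ≤ _ := by gcongr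
  calc _ ≤ μ (⋃ a, T a) := by
        refine measure_mono ?_
        rintro x ⟨hx, hxr, hxF, hxb⟩
        exact Set.mem_iUnion.2 ⟨(fun i => q (x i), fun i => q (x (k + i)),
          fun i => q (x (k + d + k + i))), hx, hxr, hxF, hxb, fun _ => rfl, fun _ => rfl,
          fun _ => rfl⟩
    _ ≤ ∑' a, μ (T a) := measure_iUnion_le _
    _ ≤ ∑' a : (Fin k → J) × (Fin d → J) × (Fin t → J),
          c ^ 5 * (z a.1 * (ν a.2.1 * ∏ i, c * p (a.2.2 i))) := ENNReal.tsum_le_tsum hT_le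
    _ = c ^ 5 * ((∑' v, z v) * ((∑' u, ν u) * (∑' j, c * p j) ^ t)) := by
        rw [ENNReal.tsum_mul_left, ENNReal.tsum_prod', ← ENNReal.tsum_pi_prod]
        simp only [ENNReal.tsum_mul_left, ENNReal.tsum_mul_right, ENNReal.tsum_prod']
    _ ≤ c ^ 5 * (sqSum A μ k * (1 * (c * μ {x | q (x 0) ∉ F}) ^ t)) := by
        rw [hz_sum, ENNReal.tsum_mul_left]
        gcongr
        exact tsum_classCyl_le_one hqm μ d
    _ = _ := by rw [one_mul, mul_assoc]

lemma measurableSet_repSet {q : I → J} (hqm : Measurable q) (k l : ℕ) :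
    MeasurableSet (repSet q k l) := by
  have : repSet q k l = ⋂ m < k, ⋃ j : J, {x | q (x m) = j} ∩ {x | q (x (l + m)) = j} := by
    ext x
    simp [repSet, eq_comm]
  rw [this]
  refine MeasurableSet.iInter fun m => MeasurableSet.iInter fun _ => MeasurableSet.iUnion fun j => ?_
  exact ((hqm.comp (measurable_pi_apply _)) (measurableSet_singleton j)).inter
    ((hqm.comp (measurable_pi_apply _)) (measurableSet_singleton j))

lemma measurableSet_visitSet {q : I → J} (hqm : Measurable q) (F : Set J) :
    MeasurableSet (visitSet q F) := by
  have : visitSet q F = ⋂ N, ⋃ i, (fun x : SeqSp I => q (x (N + i))) ⁻¹' F := by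
    ext x
    simp [visitSet]
  rw [this]
  exact MeasurableSet.iInter fun N => MeasurableSet.iUnion fun i =>
    (hqm.comp (measurable_pi_apply _)) F.to_countable.measurableSet

lemma exists_measure_repSet_inter_visitSet_le {q : I → J} (hqm : Measurable q) (hq : Unsplit q)
    {A : I → I → Bool} {φ : SeqSp I → ℝ} {μ : Measure (SeqSp I)} [IsProbabilityMeasure μ]
    (hsupp : μ (SigmaA A) = 1) {c : ℝ≥0∞} (hc : c ≠ ∞) {P : ℝ}
    (hG : ∀ x ∈ SigmaA A, ∀ m : ℕ,
      μ (cylAt A x m) ≤ c * gibbsWeight φ P m x ∧ gibbsWeight φ P m x ≤ c * μ (cylAt A x m))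
    {F : Set J} (hF : (q ⁻¹' F).Finite) (hη : c * μ {x | q (x 0) ∉ F} < 1) :
    ∃ K : ℝ≥0∞, K ≠ ∞ ∧ ∀ k l, k ≤ l →
      μ (repSet q k l ∩ visitSet q F) ≤ K * sqSum A μ k := by
  classical
  set η := c * μ {x | q (x 0) ∉ F} with hη_def
  refine ⟨hF.toFinset.card * (c ^ 5 * (1 - η)⁻¹), ?_, fun k l hkl => ?_⟩
  · refine ENNReal.mul_ne_top (ENNReal.natCast_ne_top _) (ENNReal.mul_ne_top (by finiteness) ?_)
    exact ENNReal.inv_ne_top.2 (tsub_pos_of_lt hη).ne'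
  obtain ⟨d, rfl⟩ := Nat.exists_eq_add_of_le hkl
  set G : ℕ → I → Set (SeqSp I) := fun t b =>
    {x | x ∈ SigmaA A ∧ x ∈ repSet q k (k + d) ∧ (∀ i < t, q (x (k + d + k + i)) ∉ F) ∧
        x (k + d + k + t) = b}
  rw [measure_eq_measure_SigmaA_inter hsupp
    ((measurableSet_repSet hqm _ _).inter (measurableSet_visitSet hqm _))]
  calc _ ≤ μ (⋃ b ∈ hF.toFinset, ⋃ t, G t b) := by
        refine measure_mono ?_
        rintro x ⟨hx, hxr, hxv⟩
        have h := hxv (k + d + k)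
        simp only [Set.mem_iUnion]
        exact ⟨x (k + d + k + Nat.find h), hF.mem_toFinset.2 (Nat.find_spec h), Nat.find h, hx, hxr,
          fun i hi => Nat.find_min h hi, rfl⟩
    _ ≤ ∑ b ∈ hF.toFinset, μ (⋃ t, G t b) := measure_biUnion_finset_le _ _
    _ ≤ ∑ b ∈ hF.toFinset, ∑' t, c ^ 5 * sqSum A μ k * η ^ t := by
        gcongr with b
        exact (measure_iUnion_le _).trans (ENNReal.tsum_le_tsum fun t =>
          measure_repSet_inter_firstVisit_le hqm hq hG F k d t b)
    _ = _ := by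
        rw [Finset.sum_const, ENNReal.tsum_mul_left, ENNReal.tsum_geometric, nsmul_eq_mul]
        ring

lemma ae_recurrent {q : I → J} (hqm : Measurable q) {μ : Measure (SeqSp I)} [IsFiniteMeasure μ]
    (hinv : MeasurePreserving (shift : SeqSp I → SeqSp I) μ μ) :
    ∀ᵐ x ∂μ, ∀ F : Set J, q (x 0) ∈ F → x ∈ visitSet q F := by
  have h : ∀ j : J, ∀ᵐ x ∂μ, x ∈ {y : SeqSp I | q (y 0) = j} →
      ∃ᶠ n in atTop, shift^[n] x ∈ {y : SeqSp I | q (y 0) = j} := fun j =>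
    hinv.conservative.ae_mem_imp_frequently_image_mem
      (((hqm.comp (measurable_pi_apply 0)) (measurableSet_singleton j)).nullMeasurableSet)
  filter_upwards [ae_all_iff.2 h] with x hx F hF N
  obtain ⟨n, hn, hxn⟩ := frequently_atTop.1 (hx _ rfl) N
  refine ⟨n - N, ?_⟩
  change q (shift^[n] x 0) = q (x 0) at hxn
  rw [shift_iterate_apply, zero_add] at hxn
  rwa [Nat.add_sub_cancel' hn, hxn]

end Repetition

lemma exists_measurable_unsplit (I : Type) [Countable I] [MeasurableSpace I] :
    ∃ (J : Type) (_ : Countable J) (_ : MeasurableSpace J) (_ : MeasurableSingletonClass J)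
      (q : I → J), Measurable q ∧ Unsplit q := by
  let _ : MeasurableSpace (Set.range (measurableAtom : I → Set I)) := ⊤
  have hself : ∀ a : I, a ∈ measurableAtom a := mem_measurableAtom_self
  have hmem : ∀ {a b : I}, measurableAtom a = measurableAtom b ↔ b ∈ measurableAtom a := by
    refine fun {a b} => ⟨fun h => h ▸ hself b, fun h => ?_⟩
    have hba : measurableAtom b ⊆ measurableAtom a :=
      fun y hy => mem_of_mem_measurableAtom hy (MeasurableSet.measurableAtom_of_countable a) h
    refine (hba.antisymm fun y hy => ?_).symm
    by_contra hyb
    have ha : a ∈ (measurableAtom b)ᶜ := fun hab =>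
      hyb (mem_of_mem_measurableAtom hy (MeasurableSet.measurableAtom_of_countable b) hab)
    exact mem_of_mem_measurableAtom h (MeasurableSet.measurableAtom_of_countable b).compl ha
      (hself b)
  refine ⟨Set.range (measurableAtom : I → Set I), (Set.countable_range _).to_subtype,
    inferInstance, ⟨fun _ => trivial⟩,
    Set.rangeFactorization measurableAtom, ?_, fun a b hab s hs => ?_⟩
  · have : Countable (Set.range (measurableAtom : I → Set I)) := (Set.countable_range _).to_subtype
    refine measurable_to_countable' ?_
    rintro ⟨_, a, rfl⟩
    convert MeasurableSet.measurableAtom_of_countable a using 1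
    ext b
    rw [Set.mem_preimage, Set.mem_singleton_iff, ← hmem, eq_comm]
    exact Subtype.ext_iff
  · have hab' : measurableAtom a = measurableAtom b := congrArg Subtype.val hab
    exact ⟨mem_of_mem_measurableAtom (hab' ▸ hself b) hs,
      mem_of_mem_measurableAtom (hab' ▸ hself a) hs⟩

/-- In the Gibbs setting with `H₂(μ) > 0`, for `μ`-a.e. `x`,
`limsup_n M_n(x)/log n ≤ 2/H₂(μ)`. -/
theorem matching_limsup_upper_bound
    {I : Type} [Countable I] [MeasurableSpace I]
    (A : I → I → Bool) (φ : SeqSp I → ℝ) (μ : Measure (SeqSp I))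
    [IsProbabilityMeasure μ]
    (hmix : TopMixing A) (hbip : BIP A) (hholder : LocallyHolder A φ)
    (hPGfin : ∃ PG : ℝ, HasGurevichPressure A φ PG)
    (hinv : MeasurePreserving (shift : SeqSp I → SeqSp I) μ μ)
    (hsupp : μ (SigmaA A) = 1)
    (hgibbs : IsGibbs A φ μ)
    (H₂ : ℝ) (hH₂ : HasRenyi A μ H₂) (hpos : 0 < H₂) :
    ∀ᵐ x ∂μ, Filter.limsup (fun n : ℕ => (Mn n x : ℝ) / Real.log (n : ℝ)) atTop
      ≤ 2 / H₂ := by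
  obtain ⟨J, _, _, _, q, hqm, hq⟩ := exists_measurable_unsplit I
  obtain ⟨c, hc, P, hG⟩ := hgibbs.exists_gibbsWeight
  obtain ⟨n, hn, hZn⟩ := ((eventually_ge_atTop 2).and
    (hH₂.eventually_sqSum_le (half_pos hpos) (half_lt_self hpos))).exists
  have hfib : ∀ j, (q ⁻¹' {j}).Finite :=
    finite_fibre_of_sqSum_ne_top hq hbip hG hn (ne_top_of_le_ne_top ENNReal.ofReal_ne_top hZn)
  have hne : Nonempty J := by
    obtain ⟨x, -⟩ : (SigmaA A).Nonempty := nonempty_of_measure_ne_zero (hsupp ▸ one_ne_zero)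
    exact ⟨q (x 0)⟩
  obtain ⟨e, he⟩ := exists_surjective_nat J
  set F : ℕ → Set J := fun N => e '' Set.Iio N with hF
  have hFfin : ∀ N, (q ⁻¹' F N).Finite := fun N =>
    ((Set.finite_Iio N).image e).preimage' fun j _ => hfib j
  have hFmono : Monotone F := fun N N' h => Set.image_mono (Set.Iio_subset_Iio h)
  have htend : Tendsto (fun N => c * μ {x | q (x 0) ∉ F N}) atTop (𝓝 0) := by
    have h := tendsto_measure_iInter_atTop (μ := μ) (s := fun N => {x : SeqSp I | q (x 0) ∉ F N})
      (fun N => ((hqm.comp (measurable_pi_apply 0))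
        (F N)ᶜ.to_countable.measurableSet).nullMeasurableSet)
      (fun N N' hN x hx hx' => hx (hFmono hN hx')) ⟨0, measure_ne_top _ _⟩
    have hempty : ⋂ N, {x : SeqSp I | q (x 0) ∉ F N} = ∅ := by
      refine Set.eq_empty_of_forall_notMem fun x hx => ?_
      obtain ⟨i, hi⟩ := he (q (x 0))
      exact Set.mem_iInter.1 hx (i + 1) ⟨i, Nat.lt_succ_self i, hi⟩
    rw [hempty, measure_empty] at h
    simpa using ENNReal.Tendsto.const_mul h (Or.inr hc)
  obtain ⟨N₀, hN₀⟩ := eventually_atTop.1 (htend.eventually_lt_const one_pos)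
  have hae : ∀ m N : ℕ, ∀ᵐ x ∂μ, N₀ ≤ N → x ∈ visitSet q (F N) → ∀ᶠ n : ℕ in atTop,
      (Mn n x : ℝ) ≤ (2 / H₂ + 1 / ((m : ℝ) + 1)) * Real.log n := by
    intro m N
    by_cases hN : N₀ ≤ N
    · obtain ⟨K, hK, hZ⟩ :=
        exists_measure_repSet_inter_visitSet_le hqm hq hsupp hc hG (hFfin N) (hN₀ N hN)
      have hm : (0 : ℝ) < 1 / ((m : ℝ) + 1) := by positivity
      set a := 2 / H₂ + 1 / ((m : ℝ) + 1) with ha_def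
      have ha : 0 < a := by positivity
      have haH : 2 / a < H₂ := by
        rw [div_lt_comm₀ ha hpos]
        linarith
      obtain ⟨r, har, hrH⟩ := exists_between haH
      have hr : 0 < r := lt_trans (by positivity) har
      filter_upwards [ae_eventually_Mn_le hinv hK hZ ha hr ((div_lt_iff₀' ha).1 har)
        (hH₂.eventually_sqSum_le hr hrH)] with x hx _ using hx
    · exact Eventually.of_forall fun x h => absurd h hN
  filter_upwards [ae_all_iff.2 fun m => ae_all_iff.2 (hae m), ae_recurrent hqm hinv] with x hx hrec
  obtain ⟨i, hi⟩ := he (q (x 0))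
  have hvisit : x ∈ visitSet q (F (max N₀ (i + 1))) :=
    hrec _ (hFmono (le_max_right _ _) ⟨i, Nat.lt_succ_self i, hi⟩)
  refine le_of_forall_pos_le_add fun ε hε => ?_
  obtain ⟨m, hm⟩ := exists_nat_one_div_lt hε
  refine le_trans ?_ (add_le_add_right hm.le _)
  refine limsup_le_of_le ?_ ?_
  · exact isCoboundedUnder_le_of_le atTop (x := 0) fun n =>
      div_nonneg (Nat.cast_nonneg _) (Real.log_natCast_nonneg n)
  · filter_upwards [hx m _ (le_max_left _ _) hvisit, eventually_gt_atTop 1] with n hn hn1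
    exact (div_le_iff₀ (Real.log_pos (Nat.one_lt_cast.2 hn1))).2 hn
end

section
/- Let T : X → X be a piecewise expanding Gibbs-Markov interval map on a closed interval X ⊆ ℝ with invariant Gibbs probability measure μ admitting exponential decay of correlations for bounded-variation observables against L¹ observables, and with lower correlation dimension D̲₂(μ) > 0. Then for μ-almost every x, limsup_{n→∞} (log m_n^>(x))/(−log n) ≤ 2/D̲₂(μ), where m_n^>(x) = min{ |Tⁱx − Tʲx| : 0 ≤ i < j < n, j − i > (log n)² }. -/
open MeasureTheory Filter Topology

/-- Elements of the refined partition `𝓟_n = ⋁_{j<n} T^{-j} 𝓟`. -/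
def cylN (T : ℝ → ℝ) (P : Set (Set ℝ)) (n : ℕ) : Set (Set ℝ) :=
  {Q | ∃ f : Fin n → Set ℝ, (∀ i, f i ∈ P) ∧ Q = ⋂ i : Fin n, T^[(i : ℕ)] ⁻¹' f i}

/-- The separation time of two points: the largest `n` such that `x` and `y` lie in a
common element of `𝓟_n`. -/
noncomputable def sepTime (T : ℝ → ℝ) (P : Set (Set ℝ)) (x y : ℝ) : ℕ :=
  sSup {n : ℕ | ∃ Q ∈ cylN T P n, x ∈ Q ∧ y ∈ Q}

/-- Total variation of `f` on `X`. -/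
noncomputable def TV (f : ℝ → ℝ) (X : Set ℝ) : ℝ := (eVariationOn f X).toReal

/-- A piecewise expanding interval map with bounded distortion and a Gibbs-Markov
structure, together with its invariant Gibbs probability measure `μ`. `DT` is the
derivative of `T` on the partition elements. -/
structure GibbsMarkovMap (X : Set ℝ) (T : ℝ → ℝ) (P : Set (Set ℝ)) (DT : ℝ → ℝ)
    (μ : Measure ℝ) : Prop where
  closedInterval : ∃ a b : ℝ, a ≤ b ∧ X = Set.Icc a b
  mapsTo : Set.MapsTo T X X
  countableP : P.Countable
  partSub : ∀ p ∈ P, p ⊆ X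
  partDisj : P.PairwiseDisjoint id
  partCover : volume (X \ ⋃₀ P) = 0
  hasDeriv : ∀ p ∈ P, ∀ x ∈ p, HasDerivWithinAt T (DT x) p x
  expanding : ∃ γ > (0 : ℝ), ∀ p ∈ P, ∀ x ∈ p, γ < |DT x|
  distortion : ∃ C > (0 : ℝ), ∀ n : ℕ, ∀ Q ∈ cylN T P n, ∀ x ∈ Q, ∀ y ∈ Q,
    ∏ i ∈ Finset.range n, |DT (T^[i] x)| ≤ C * ∏ i ∈ Finset.range n, |DT (T^[i] y)|
  markovImage : ∀ p ∈ P, ∃ S ⊆ P, T '' p = ⋃₀ S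
  markovInj : ∀ p ∈ P, Set.InjOn T p
  logDTLip : ∃ Cg > (0 : ℝ), ∀ p ∈ P, ∀ x ∈ p, ∀ y ∈ p,
    abs (Real.log (abs (DT x)) - Real.log (abs (DT y))) ≤ Cg * Real.exp (-((sepTime T P x y : ℕ) : ℝ))
  bigImage : ∃ δ₀ > (0 : ℝ), ∀ n ≥ 1, ∀ Q ∈ cylN T P n, Q.Nonempty →
    δ₀ ≤ (volume (T^[n] '' Q)).toReal
  prob : IsProbabilityMeasure μ
  invariant : MeasurePreserving T μ μ
  suppX : μ X = 1
  gibbs : ∃ φ : ℝ → ℝ, ∃ c > (0 : ℝ), ∃ Pr : ℝ, ∀ n : ℕ, ∀ Q ∈ cylN T P n, ∀ x ∈ Q,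
    c⁻¹ * Real.exp (-(n : ℝ) * Pr + ∑ i ∈ Finset.range n, φ (T^[i] x)) ≤ (μ Q).toReal ∧
    (μ Q).toReal ≤ c * Real.exp (-(n : ℝ) * Pr + ∑ i ∈ Finset.range n, φ (T^[i] x))

/-- Exponential decay of correlations for `BV` observables against `L¹` observables. -/
def ExpDecayBVL1 (X : Set ℝ) (T : ℝ → ℝ) (μ : Measure ℝ) : Prop :=
  ∃ C₁ > (0 : ℝ), ∃ c₁ > (0 : ℝ), ∀ n : ℕ, ∀ f g : ℝ → ℝ,
    BoundedVariationOn f X → Integrable g μ →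
    |(∫ x, f x * g (T^[n] x) ∂μ) - (∫ x, f x ∂μ) * ∫ x, g x ∂μ| ≤
      ((∫ x, |f x| ∂μ) + TV f X) * (∫ x, |g x| ∂μ) * C₁ * Real.exp (-c₁ * (n : ℝ))

/-- The upper correlation dimension `D̄₂(μ)`. -/
noncomputable def corrUpper (μ : Measure ℝ) : ℝ :=
  Filter.limsup
    (fun r : ℝ => Real.log (∫ x, (μ (Metric.ball x r)).toReal ∂μ) / Real.log r)
    (nhdsWithin 0 (Set.Ioi 0))

/-- The lower correlation dimension `D̲₂(μ)`. -/
noncomputable def corrLower (μ : Measure ℝ) : ℝ :=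
  Filter.liminf
    (fun r : ℝ => Real.log (∫ x, (μ (Metric.ball x r)).toReal ∂μ) / Real.log r)
    (nhdsWithin 0 (Set.Ioi 0))

/-- `m_n(x) = min_{0 ≤ i < j ≤ n-1} d(Tⁱx, Tʲx)`. -/
noncomputable def mAll (T : ℝ → ℝ) (n : ℕ) (x : ℝ) : ℝ :=
  sInf {d : ℝ | ∃ i j : ℕ, i < j ∧ j < n ∧ d = |T^[i] x - T^[j] x|}

/-- `m_n^>(x)`: minimum over pairs with gap larger than `(log n)²`. -/
noncomputable def mGt (T : ℝ → ℝ) (n : ℕ) (x : ℝ) : ℝ :=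
  sInf {d : ℝ | ∃ i j : ℕ, i < j ∧ j < n ∧ (Real.log n) ^ 2 < (j : ℝ) - (i : ℝ) ∧
    d = |T^[i] x - T^[j] x|}

/-- `m_n^≤(x)`: minimum over pairs with gap at most `(log n)²`. -/
noncomputable def mLe (T : ℝ → ℝ) (n : ℕ) (x : ℝ) : ℝ :=
  sInf {d : ℝ | ∃ i j : ℕ, i < j ∧ j < n ∧ (j : ℝ) - (i : ℝ) ≤ (Real.log n) ^ 2 ∧
    d = |T^[i] x - T^[j] x|}

/-- `m_n^≫(x)`: minimum over pairs with `0 ≤ i ≤ n/3` and `2n/3 ≤ j < n`. -/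
noncomputable def mGG (T : ℝ → ℝ) (n : ℕ) (x : ℝ) : ℝ :=
  sInf {d : ℝ | ∃ i j : ℕ, 3 * i ≤ n ∧ 2 * n ≤ 3 * j ∧ j < n ∧ d = |T^[i] x - T^[j] x|}

/-- The repeller `Λ` of `T`. -/
def repeller (X : Set ℝ) (T : ℝ → ℝ) (P : Set (Set ℝ)) : Set ℝ :=
  {x ∈ X | ∀ k : ℕ, T^[k] x ∈ ⋃₀ P}

/-- Indicator function (real valued) of the ball `B(u, R)`. -/
noncomputable def iball (u R : ℝ) : ℝ → ℝ := (Metric.ball u R).indicator 1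

open scoped ENNReal

section CorrelationDecay

variable {X : Set ℝ} {T : ℝ → ℝ} {μ : Measure ℝ}

/-- The indicator of a half-line has total variation at most one on a compact interval. -/
lemma eVariationOn_indicator_Ici_le {a b : ℝ} (hab : a ≤ b) (u : ℝ) :
    eVariationOn ((Set.Ici u).indicator (1 : ℝ → ℝ)) (Set.Icc a b) ≤ 1 := by
  have hmono : Monotone ((Set.Ici u).indicator (1 : ℝ → ℝ)) := by
    intro x y hxy
    by_cases hx : u ≤ x
    · simp [Set.indicator, hx, hx.trans hxy]
    · by_cases hy : u ≤ y <;> simp [Set.indicator, hx, hy]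
  have h := (hmono.monotoneOn (Set.Icc a b)).eVariationOn_eq
    (Set.left_mem_Icc.2 hab) (Set.right_mem_Icc.2 hab)
  rw [Set.inter_self] at h
  refine h.le.trans (ENNReal.ofReal_le_one.2 ?_)
  by_cases hx : u ≤ a <;> by_cases hy : u ≤ b <;> simp [Set.indicator, hx, hy]

/-- Decorrelation of half-lines from measurable sets. -/
lemma ExpDecayBVL1.exists_abs_real_Ici_inter_sub_le [IsProbabilityMeasure μ]
    (hX : ∃ a b : ℝ, a ≤ b ∧ X = Set.Icc a b) (hT : Measurable T) (h : ExpDecayBVL1 X T μ) :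
    ∃ C > (0 : ℝ), ∃ c > (0 : ℝ), ∀ (k : ℕ) (u : ℝ) (S : Set ℝ), MeasurableSet S →
      |μ.real (Set.Ici u ∩ T^[k] ⁻¹' S) - μ.real (Set.Ici u) * μ.real S| ≤
        μ.real S * (C * Real.exp (-c * k)) := by
  obtain ⟨a, b, hab, rfl⟩ := hX
  obtain ⟨C, hC, c, hc, h⟩ := h
  refine ⟨2 * C, by positivity, c, hc, fun k u S hS => ?_⟩
  have hvar := eVariationOn_indicator_Ici_le hab u
  have h1 := h k ((Set.Ici u).indicator 1) (S.indicator 1)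
    (ne_top_of_le_ne_top ENNReal.one_ne_top hvar)
    ((integrable_indicator_iff hS).2 (integrable_const (1 : ℝ)).integrableOn)
  have hTV : TV ((Set.Ici u).indicator 1) (Set.Icc a b) ≤ 1 := by
    simpa [TV] using ENNReal.toReal_mono ENNReal.one_ne_top hvar
  have habs : ∀ A : Set ℝ, (fun x => |A.indicator (1 : ℝ → ℝ) x|) = A.indicator 1 := by
    intro A
    ext x
    by_cases hx : x ∈ A <;> simp [hx]
  have hprod : (fun x => (Set.Ici u).indicator (1 : ℝ → ℝ) x * S.indicator (1 : ℝ → ℝ) (T^[k] x))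
      = (Set.Ici u ∩ T^[k] ⁻¹' S).indicator 1 := by
    ext x
    by_cases hx : u ≤ x <;> by_cases hy : T^[k] x ∈ S <;> simp [Set.indicator, hx, hy]
  rw [hprod, habs, habs, integral_indicator_one (measurableSet_Ici.inter (hT.iterate k hS)),
    integral_indicator_one hS, integral_indicator_one measurableSet_Ici] at h1
  refine h1.trans ?_
  have h2 : μ.real (Set.Ici u) + TV ((Set.Ici u).indicator 1) (Set.Icc a b) ≤ 2 := by
    linarith [measureReal_le_one (μ := μ) (s := Set.Ici u)]
  calc _ ≤ 2 * μ.real S * C * Real.exp (-c * k) := by gcongr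
    _ = _ := by ring

/-- Decorrelation of half-open intervals from measurable sets. -/
lemma ExpDecayBVL1.exists_measure_Ico_inter_le [IsProbabilityMeasure μ]
    (hX : ∃ a b : ℝ, a ≤ b ∧ X = Set.Icc a b) (hT : Measurable T) (h : ExpDecayBVL1 X T μ) :
    ∃ C > (0 : ℝ), ∃ c > (0 : ℝ), ∀ (k : ℕ) (u v : ℝ) (S : Set ℝ), u ≤ v → MeasurableSet S →
      μ (Set.Ico u v ∩ T^[k] ⁻¹' S) ≤
        μ (Set.Ico u v) * μ S + μ S * ENNReal.ofReal (C * Real.exp (-c * k)) := by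
  obtain ⟨C, hC, c, hc, h⟩ := h.exists_abs_real_Ici_inter_sub_le hX hT
  refine ⟨2 * C, by positivity, c, hc, fun k u v S huv hS => ?_⟩
  have hTS : MeasurableSet (T^[k] ⁻¹' S) := hT.iterate k hS
  have hIco : Set.Ico u v = Set.Ici u \ Set.Ici v := by ext; simp
  have hsub : Set.Ici v ⊆ Set.Ici u := Set.Ici_subset_Ici.2 huv
  have e1 : μ.real (Set.Ico u v) = μ.real (Set.Ici u) - μ.real (Set.Ici v) := by
    rw [hIco, measureReal_sdiff hsub measurableSet_Ici]
  have e2 : μ.real (Set.Ico u v ∩ T^[k] ⁻¹' S) =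
      μ.real (Set.Ici u ∩ T^[k] ⁻¹' S) - μ.real (Set.Ici v ∩ T^[k] ⁻¹' S) := by
    rw [← measureReal_sdiff (Set.inter_subset_inter_left _ hsub) (measurableSet_Ici.inter hTS)]
    congr 1
    ext
    simp only [Set.mem_inter_iff, Set.mem_Ico, Set.mem_sdiff, Set.mem_Ici, ← not_le]
    tauto
  have hu := abs_le.1 (h k u S hS)
  have hv := abs_le.1 (h k v S hS)
  have key : μ.real (Set.Ico u v ∩ T^[k] ⁻¹' S) ≤
      μ.real (Set.Ico u v) * μ.real S + μ.real S * (2 * C * Real.exp (-c * k)) := by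
    rw [e1, e2]
    linarith [hu.2, hv.1]
  rw [← ofReal_measureReal, ← ofReal_measureReal (s := Set.Ico u v),
    ← ofReal_measureReal (s := S), ← ENNReal.ofReal_mul (by positivity),
    ← ENNReal.ofReal_mul (by positivity), ← ENNReal.ofReal_add (by positivity) (by positivity)]
  exact ENNReal.ofReal_le_ofReal key

/-- Measure of the set of points which return within distance `r` after `k` steps. -/
lemma ExpDecayBVL1.exists_measure_return_le [IsProbabilityMeasure μ]
    (hX : ∃ a b : ℝ, a ≤ b ∧ X = Set.Icc a b) (hT : Measurable T) (h : ExpDecayBVL1 X T μ) :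
    ∃ C > (0 : ℝ), ∃ c > (0 : ℝ), ∀ (k : ℕ) (r : ℝ), 0 < r →
      μ {x | |x - T^[k] x| < r} ≤
        (∫⁻ x, μ (Metric.ball x (2 * r)) ∂μ) + ENNReal.ofReal (C * Real.exp (-c * k)) := by
  obtain ⟨C, hC, c, hc, h⟩ := h.exists_measure_Ico_inter_le hX hT
  refine ⟨3 * C, by positivity, c, hc, fun k r hr => ?_⟩
  let I : ℤ → Set ℝ := fun l => Set.Ico (l • r) ((l + 1) • r)
  let J : ℤ → Set ℝ := fun l => Set.Ico ((l - 1) • r) ((l + 2) • r)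
  have hI : ∀ l, MeasurableSet (I l) := fun l => measurableSet_Ico
  have hIdisj : Pairwise (Function.onFun Disjoint I) := Set.pairwise_disjoint_Ico_zsmul r
  have hIcov : ⋃ l, I l = Set.univ := iUnion_Ico_zsmul hr
  have hsumI : ∑' l, μ (I l) = 1 := by
    rw [← measure_iUnion hIdisj hI, hIcov, measure_univ]
  have hcover : {x | |x - T^[k] x| < r} ⊆ ⋃ l, I l ∩ T^[k] ⁻¹' J l := by
    intro x hx
    obtain ⟨l, hl⟩ := Set.mem_iUnion.1 (hIcov ▸ Set.mem_univ x)
    refine Set.mem_iUnion.2 ⟨l, hl, ?_⟩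
    simp only [I, J, Set.mem_Ico, zsmul_eq_mul, Set.mem_preimage, Set.mem_ofPred_eq] at hl hx ⊢
    push_cast at hl ⊢
    have := abs_lt.1 hx
    constructor <;> linarith
  have hJ : ∀ l, μ (J l) ≤ μ (I (l - 1)) + μ (I l) + μ (I (l + 1)) := by
    intro l
    have : J l ⊆ (I (l - 1) ∪ I l) ∪ I (l + 1) := by
      intro y hy
      simp only [I, J, Set.mem_union, Set.mem_Ico, zsmul_eq_mul] at hy ⊢
      push_cast at hy ⊢
      rcases lt_or_ge y (l * r) with h1 | h1
      · left; left; constructor <;> linarith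
      · rcases lt_or_ge y ((l + 1) * r) with h2 | h2
        · left; right; exact ⟨h1, h2⟩
        · right; constructor <;> linarith
    exact (measure_mono this).trans <| (measure_union_le _ _).trans
      (by gcongr; exact measure_union_le _ _)
  have hsumJ : ∑' l, μ (J l) ≤ 3 := by
    refine (ENNReal.tsum_le_tsum hJ).trans ?_
    have hsub : ∑' l, μ (I (l - 1)) = 1 :=
      ((Equiv.subRight (1 : ℤ)).tsum_eq fun l => μ (I l)).trans hsumI
    have hadd : ∑' l, μ (I (l + 1)) = 1 :=
      ((Equiv.addRight (1 : ℤ)).tsum_eq fun l => μ (I l)).trans hsumI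
    rw [ENNReal.tsum_add, ENNReal.tsum_add, hsumI, hsub, hadd]
    norm_num
  have hIJ : ∑' l, μ (I l) * μ (J l) ≤ ∫⁻ x, μ (Metric.ball x (2 * r)) ∂μ := by
    rw [← setLIntegral_univ, ← hIcov, lintegral_iUnion hI hIdisj]
    refine ENNReal.tsum_le_tsum fun l => ?_
    rw [mul_comm, ← setLIntegral_const]
    refine setLIntegral_mono' (hI l) fun x hx => measure_mono fun y hy => ?_
    simp only [I, J, Set.mem_Ico, zsmul_eq_mul, Metric.mem_ball, Real.dist_eq] at hx hy ⊢
    push_cast at hx hy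
    rw [abs_lt]
    constructor <;> linarith
  calc μ {x | |x - T^[k] x| < r}
      ≤ ∑' l, μ (I l ∩ T^[k] ⁻¹' J l) := (measure_mono hcover).trans (measure_iUnion_le _)
    _ ≤ ∑' l, (μ (I l) * μ (J l) + μ (J l) * ENNReal.ofReal (C * Real.exp (-c * k))) := by
        refine ENNReal.tsum_le_tsum fun l => h k _ _ _ ?_ measurableSet_Ico
        simp only [zsmul_eq_mul]
        push_cast
        linarith
    _ = ∑' l, μ (I l) * μ (J l) + (∑' l, μ (J l)) * ENNReal.ofReal (C * Real.exp (-c * k)) := by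
        rw [ENNReal.tsum_add, ENNReal.tsum_mul_right]
    _ ≤ _ := by
        rw [mul_assoc 3 C, ENNReal.ofReal_mul (by norm_num : (0 : ℝ) ≤ 3)]
        simp only [ENNReal.ofReal_ofNat]
        gcongr

end CorrelationDecay

/-- Below the lower correlation dimension, the mean measure of small balls is bounded by a
power of the radius. -/
lemma eventually_lintegral_ball_le {μ : Measure ℝ} [IsProbabilityMeasure μ] {s : ℝ}
    (hs0 : 0 < s) (hs : s < corrLower μ) :
    ∀ᶠ r in 𝓝[>] (0 : ℝ), ∫⁻ x, μ (Metric.ball x r) ∂μ ≤ ENNReal.ofReal (r ^ s) := by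
  have hne : {a : ℝ | ∀ᶠ r in 𝓝[>] (0 : ℝ),
      a ≤ Real.log (∫ x, (μ (Metric.ball x r)).toReal ∂μ) / Real.log r}.Nonempty := by
    by_contra hempty
    rw [Set.not_nonempty_iff_eq_empty] at hempty
    rw [corrLower, liminf_eq, hempty, Real.sSup_empty] at hs
    linarith
  rw [corrLower, liminf_eq] at hs
  obtain ⟨a, ha, hsa⟩ := exists_lt_of_lt_csSup hne hs
  filter_upwards [ha, Ioo_mem_nhdsGT (zero_lt_one (α := ℝ))] with r hr hr01
  have hmeas : Measurable fun x => μ (Metric.ball x r) := by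
    have : MeasurableSet {p : ℝ × ℝ | dist p.2 p.1 < r} :=
      measurableSet_lt (measurable_snd.dist measurable_fst) measurable_const
    exact measurable_measure_prodMk_left this
  have hfin : ∫⁻ x, μ (Metric.ball x r) ∂μ ≠ ∞ := by
    refine ne_top_of_le_ne_top ENNReal.one_ne_top ((lintegral_mono fun x => prob_le_one).trans ?_)
    simp
  rw [integral_toReal hmeas.aemeasurable (by simp)] at hr
  rw [ENNReal.le_ofReal_iff_toReal_le hfin (by have := hr01.1; positivity)]
  rcases (ENNReal.toReal_nonneg (a := ∫⁻ x, μ (Metric.ball x r) ∂μ)).eq_or_lt with h0 | hpos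
  · rw [← h0]
    exact Real.rpow_nonneg hr01.1.le _
  · rw [← Real.log_le_log_iff hpos (Real.rpow_pos_of_pos hr01.1 _), Real.log_rpow hr01.1]
    exact (le_div_iff_of_neg (Real.log_neg hr01.1 hr01.2)).1 (hsa.le.trans hr)

section CloseReturns

variable {T : ℝ → ℝ} {μ : Measure ℝ}

/-- The points whose orbit up to time `N` comes `r`-close to itself with time gap above `L`. -/
def closeReturns (T : ℝ → ℝ) (N : ℕ) (L r : ℝ) : Set ℝ :=
  {x | ∃ i j : ℕ, i < j ∧ j < N ∧ L < (j : ℝ) - (i : ℝ) ∧ |T^[i] x - T^[j] x| < r}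

lemma measure_closeReturns_le {B : ℝ≥0∞} {N : ℕ} {L r : ℝ} (hT : MeasurePreserving T μ μ)
    (hB : ∀ k : ℕ, L < k → μ {x | |x - T^[k] x| < r} ≤ B) :
    μ (closeReturns T N L r) ≤ N ^ 2 * B := by
  classical
  let D : ℕ → Set ℝ := fun k => {x | |x - T^[k] x| < r}
  have hD : ∀ k, MeasurableSet (D k) := fun k =>
    measurableSet_lt (measurable_id.sub (hT.measurable.iterate k)).abs measurable_const
  let s := (Finset.range N ×ˢ Finset.range N).filter
    fun p : ℕ × ℕ => p.1 < p.2 ∧ L < (p.2 : ℝ) - p.1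
  have hcover : closeReturns T N L r ⊆ ⋃ p ∈ s, T^[p.1] ⁻¹' D (p.2 - p.1) := by
    rintro x ⟨i, j, hij, hj, hL, hx⟩
    refine Set.mem_biUnion (x := (i, j)) (by simp [s, hij, hj, hL, hij.trans hj]) ?_
    change |T^[i] x - T^[j - i] (T^[i] x)| < r
    rwa [← Function.iterate_add_apply, Nat.sub_add_cancel hij.le]
  calc μ (closeReturns T N L r)
      ≤ ∑ p ∈ s, μ (T^[p.1] ⁻¹' D (p.2 - p.1)) :=
        (measure_mono hcover).trans (measure_biUnion_finset_le _ _)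
    _ ≤ ∑ _p ∈ s, B := by
        refine Finset.sum_le_sum fun p hp => ?_
        obtain ⟨-, hlt, hL⟩ := Finset.mem_filter.1 hp
        rw [(hT.iterate p.1).measure_preimage (hD _).nullMeasurableSet]
        exact hB _ (by rwa [Nat.cast_sub hlt.le])
    _ = s.card * B := by rw [Finset.sum_const, nsmul_eq_mul]
    _ ≤ N ^ 2 * B := by
        gcongr
        have : s.card ≤ N * N := (Finset.card_filter_le _ _).trans (by simp)
        rw [sq]
        exact_mod_cast this

/-- Along dyadic times, the close-return events have geometrically small measure. -/
lemma exists_eventually_measure_closeReturns_le {C c s a : ℝ} (hT : MeasurePreserving T μ μ)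
    (hC : 0 < C) (hc : 0 < c) (ha : 0 < a)
    (hret : ∀ (k : ℕ) (r : ℝ), 0 < r → μ {x | |x - T^[k] x| < r} ≤
      (∫⁻ x, μ (Metric.ball x (2 * r)) ∂μ) + ENNReal.ofReal (C * Real.exp (-c * k)))
    (hball : ∀ᶠ r in 𝓝[>] (0 : ℝ), ∫⁻ x, μ (Metric.ball x r) ∂μ ≤ ENNReal.ofReal (r ^ s)) :
    ∃ K : ℝ, ∀ᶠ k : ℕ in atTop,
      μ (closeReturns T (2 ^ (k + 1)) (Real.log (2 ^ k) ^ 2) ((2 ^ k : ℝ) ^ (-a))) ≤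
        ENNReal.ofReal (K * (4 * (2 : ℝ) ^ (-(a * s))) ^ k) := by
  refine ⟨4 * (2 ^ s + C), ?_⟩
  have hpow : ∀ (k : ℕ) (t : ℝ), (2 ^ k : ℝ) ^ t = ((2 : ℝ) ^ t) ^ k := fun k t => by
    rw [← Real.rpow_natCast, ← Real.rpow_natCast, ← Real.rpow_mul zero_le_two,
      ← Real.rpow_mul zero_le_two, mul_comm]
  have hlim : Tendsto (fun k : ℕ => 2 * (2 ^ k : ℝ) ^ (-a)) atTop (𝓝[>] 0) := by
    refine tendsto_nhdsWithin_iff.2 ⟨?_, Eventually.of_forall fun k => ?_⟩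
    · simp only [hpow]
      have := (tendsto_pow_atTop_nhds_zero_of_lt_one (by positivity)
        (Real.rpow_lt_one_of_one_lt_of_neg one_lt_two (neg_lt_zero.2 ha))).const_mul (2 : ℝ)
      simpa using this
    · simp only [Set.mem_Ioi]
      positivity
  have hlog2 : 0 < Real.log 2 := Real.log_pos one_lt_two
  have hlarge : ∀ᶠ k : ℕ in atTop, a * s / (c * Real.log 2) ≤ (k : ℝ) :=
    tendsto_natCast_atTop_atTop.eventually_ge_atTop _
  filter_upwards [hlim.eventually hball, hlarge] with k hk hk'
  set q : ℝ := (2 : ℝ) ^ (-(a * s)) with hq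
  have hq0 : 0 < q := by positivity
  have hrad : (2 * (2 ^ k : ℝ) ^ (-a)) ^ s = 2 ^ s * q ^ k := by
    rw [Real.mul_rpow zero_le_two (by positivity), ← Real.rpow_mul (by positivity), hpow]
    congr 3
    ring
  have hexp : ∀ m : ℕ, Real.log (2 ^ k) ^ 2 < m → Real.exp (-c * m) ≤ q ^ k := by
    intro m hm
    rw [hq, Real.rpow_def_of_pos zero_lt_two, ← Real.exp_nat_mul]
    refine Real.exp_le_exp.2 ?_
    rw [Real.log_pow] at hm
    rw [div_le_iff₀ (by positivity)] at hk'
    have h1 := mul_le_mul_of_nonneg_left hk' (by positivity : 0 ≤ (k : ℝ) * Real.log 2)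
    have h2 := mul_le_mul_of_nonneg_left hm.le hc.le
    nlinarith
  have hB : ∀ m : ℕ, Real.log (2 ^ k) ^ 2 < m → μ {x | |x - T^[m] x| < (2 ^ k : ℝ) ^ (-a)} ≤
      ENNReal.ofReal ((2 ^ s + C) * q ^ k) := by
    intro m hm
    refine (hret m _ (by positivity)).trans ?_
    rw [add_mul, ENNReal.ofReal_add (by positivity) (by positivity), ← hrad]
    gcongr
    exact hexp m hm
  refine (measure_closeReturns_le hT hB).trans_eq ?_
  have hN : (((2 ^ (k + 1) : ℕ) : ℝ≥0∞)) ^ 2 = ENNReal.ofReal (4 * 4 ^ k) := by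
    rw [← pow_succ', ENNReal.ofReal_pow (by norm_num), ENNReal.ofReal_ofNat]
    push_cast
    rw [← pow_mul, mul_comm, pow_mul]
    norm_num
  rw [hN, ← ENNReal.ofReal_mul (by positivity)]
  congr 1
  rw [mul_pow]
  ring

/-- Outside the close-return event at the dyadic scale of `n`, the minimal distance `mGt` is at
least `n ^ (-a)`. -/
lemma log_mGt_div_le_of_notMem_closeReturns {a x : ℝ} {n : ℕ} (ha : 0 < a) (hn : 2 ≤ n)
    (hx : x ∉ closeReturns T (2 ^ (Nat.log 2 n + 1)) (Real.log (2 ^ Nat.log 2 n) ^ 2)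
      ((2 ^ Nat.log 2 n : ℝ) ^ (-a))) :
    Real.log (mGt T n x) / (-Real.log n) ≤ a := by
  have hn1 : (1 : ℝ) < n := by exact_mod_cast hn
  have hn0 : (0 : ℝ) < n := by positivity
  have hlog : 0 < Real.log n := Real.log_pos hn1
  have hle : (2 ^ Nat.log 2 n : ℝ) ≤ n := by exact_mod_cast Nat.pow_log_le_self 2 (by omega)
  have hlt : n < 2 ^ (Nat.log 2 n + 1) := Nat.lt_pow_succ_log_self one_lt_two n
  have hlogle : Real.log (2 ^ Nat.log 2 n) ^ 2 ≤ Real.log n ^ 2 := by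
    have : 0 ≤ Real.log (2 ^ Nat.log 2 n) := Real.log_nonneg (one_le_pow₀ one_le_two)
    gcongr
  rcases Set.eq_empty_or_nonempty {d : ℝ | ∃ i j : ℕ, i < j ∧ j < n ∧
    (Real.log n) ^ 2 < (j : ℝ) - (i : ℝ) ∧ d = |T^[i] x - T^[j] x|} with hempty | hne
  · rw [mGt, hempty, Real.sInf_empty, Real.log_zero, zero_div]
    exact ha.le
  · have hbound : (n : ℝ) ^ (-a) ≤ mGt T n x := by
      refine le_csInf hne ?_
      rintro d ⟨i, j, hij, hj, hgap, rfl⟩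
      by_contra! hd
      refine hx ⟨i, j, hij, hj.trans hlt, hlogle.trans_lt hgap, hd.trans_le ?_⟩
      exact Real.rpow_le_rpow_of_nonpos (by positivity) hle (by linarith)
    have hlogm := Real.log_le_log (Real.rpow_pos_of_pos hn0 _) hbound
    rw [Real.log_rpow hn0] at hlogm
    rw [div_neg, neg_le, le_div_iff₀ hlog]
    exact hlogm

end CloseReturns

/-- A real `limsup` is at most any nonnegative eventual upper bound. -/
lemma Real.limsup_le_of_eventually_le {u : ℕ → ℝ} {a : ℝ} (ha : 0 ≤ a)
    (h : ∀ᶠ n in atTop, u n ≤ a) : limsup u atTop ≤ a := by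
  rw [limsup_eq]
  by_cases hb : BddBelow {b | ∀ᶠ n in atTop, u n ≤ b}
  · exact csInf_le hb h
  · rwa [Real.sInf_of_not_bddBelow hb]

/-- For a piecewise expanding Gibbs-Markov interval map with invariant
Gibbs measure `μ` having exponential decay of correlations for BV against `L¹`
observables and `D̲₂(μ) > 0`, for `μ`-a.e. `x`,
`limsup (log m_n^>(x))/(-log n) ≤ 2/D̲₂(μ)`. -/
theorem mGt_limsup_upper_bound
    (X : Set ℝ) (T : ℝ → ℝ) (P : Set (Set ℝ)) (DT : ℝ → ℝ) (μ : Measure ℝ)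
    (hGM : GibbsMarkovMap X T P DT μ)
    (hdec : ExpDecayBVL1 X T μ)
    (hD : 0 < corrLower μ) :
    ∀ᵐ x ∂μ,
      Filter.limsup (fun n : ℕ => Real.log (mGt T n x) / (-Real.log (n : ℝ))) atTop
        ≤ 2 / corrLower μ := by
  have := hGM.prob
  have hT := hGM.invariant
  obtain ⟨C, hC, c, hc, hret⟩ := hdec.exists_measure_return_le hGM.closedInterval hT.measurable
  have hrate : ∀ a : ℝ, 2 / corrLower μ < a → ∀ᵐ x ∂μ, ∀ᶠ n : ℕ in atTop,
      Real.log (mGt T n x) / (-Real.log (n : ℝ)) ≤ a := by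
    intro a ha
    have ha0 : 0 < a := (by positivity : 0 < 2 / corrLower μ).trans ha
    obtain ⟨s, hs2, hsD⟩ := exists_between ((div_lt_comm₀ hD ha0).1 ha)
    have hs0 : 0 < s := (by positivity : 0 < 2 / a).trans hs2
    obtain ⟨K, hK⟩ := exists_eventually_measure_closeReturns_le hT hC hc ha0 hret
      (eventually_lintegral_ball_le hs0 hsD)
    obtain ⟨k₀, hk₀⟩ := eventually_atTop.1 hK
    have hq : 4 * (2 : ℝ) ^ (-(a * s)) < 1 := by
      have has : 2 < a * s := by rwa [div_lt_iff₀' ha0] at hs2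
      have h4 : (2 : ℝ) ^ (-(a * s)) < 2 ^ (-2 : ℝ) :=
        Real.rpow_lt_rpow_of_exponent_lt one_lt_two (by linarith)
      norm_num [Real.rpow_neg] at h4 ⊢
      linarith
    have hsum : Summable fun k : ℕ => K * (4 * (2 : ℝ) ^ (-(a * s))) ^ (k + k₀) :=
      ((summable_nat_add_iff k₀).2
        (summable_geometric_of_lt_one (by positivity) hq)).mul_left K
    have hfin := ne_top_of_le_ne_top hsum.tsum_ofReal_ne_top
      (ENNReal.tsum_le_tsum fun k => hk₀ (k + k₀) (Nat.le_add_left k₀ k))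
    filter_upwards [ae_eventually_notMem hfin] with x hx
    obtain ⟨k₁, hk₁⟩ := eventually_atTop.1 hx
    filter_upwards [eventually_ge_atTop (2 ^ (k₁ + k₀ + 1))] with n hn
    have hlog : k₁ + k₀ + 1 ≤ Nat.log 2 n := Nat.le_log_of_pow_le one_lt_two hn
    have hn2 : 2 ≤ n := (Nat.le_self_pow (by omega) 2).trans hn
    refine log_mGt_div_le_of_notMem_closeReturns ha0 hn2 ?_
    have h := hk₁ (Nat.log 2 n - k₀) (by omega)
    rwa [Nat.sub_add_cancel (by omega)] at h
  have hall : ∀ᵐ x ∂μ, ∀ m : ℕ, ∀ᶠ n : ℕ in atTop,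
      Real.log (mGt T n x) / (-Real.log (n : ℝ)) ≤ 2 / corrLower μ + 1 / ((m : ℝ) + 1) :=
    ae_all_iff.2 fun m => hrate _ (lt_add_of_pos_right _ (by positivity))
  filter_upwards [hall] with x hx
  have hlim : Tendsto (fun m : ℕ => 2 / corrLower μ + 1 / ((m : ℝ) + 1)) atTop
      (𝓝 (2 / corrLower μ)) := by
    simpa using tendsto_one_div_add_atTop_nhds_zero_nat.const_add (2 / corrLower μ)
  exact ge_of_tendsto' hlim fun m => Real.limsup_le_of_eventually_le (by positivity) (hx m)
end
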